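/- Let 0 → L →(i)→ D →(p)→ E → 0 be a degreewise short exact sequence of ℤ-indexed cochain complexes of abelian groups, let φ : F → D be a chain map, and let k be an integer. Write σ_{≥k}F for the brutal truncation of F (equal to F in degrees ≥ k and zero below), equipped with the chain map p∘φ restricted to σ_{≥k}F into E. Then there is a surjective group homomorphism Ξ : H^k(cone(σ_{≥k}F → E)) → H^k(cone((i,φ) : L ⊕ F → D)) whose kernel is isomorphic to the quotient of F^{k−1} by the subgroup of those η ∈ F^{k−1} with dη = 0 and whose class [φ(η)] ∈ H^{k−1}(D) lies in the image of i_* : H^{k−1}(L) → H^{k−1}(D). (This subgroup contains d(F^{k−2}), so the quotient is well defined.) -/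

import Mathlib

open Function

/-- Transport along an equality of indices, as an additive homomorphism. -/
def chom (T : ℤ → Type) [inst : ∀ n, AddCommGroup (T n)] {i j : ℤ} (h : i = j) :
    T i →+ T j := by subst h; exact AddMonoidHom.id _

@[simp] lemma chom_rfl (T : ℤ → Type) [∀ n, AddCommGroup (T n)] {i : ℤ} (x : T i) :
    chom T rfl x = x := rfl

lemma chom_chom (T : ℤ → Type) [∀ n, AddCommGroup (T n)] {i j k : ℤ}
    (h : i = j) (h' : j = k) (x : T i) :
    chom T h' (chom T h x) = chom T (h.trans h') x := by subst h; subst h'; rfl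

/-- A ℤ-indexed cochain complex of abelian groups. -/
structure CochainCpx : Type 1 where
  X : ℤ → Type
  grp : ∀ n, AddCommGroup (X n)
  d : ∀ n : ℤ, X n →+ X (n + 1)
  dsq : ∀ (n : ℤ) (x : X n), d (n + 1) (d n x) = 0

attribute [instance] CochainCpx.grp

lemma CochainCpx.d_chom (C : CochainCpx) {i j : ℤ} (h : i = j) (x : C.X i) :
    C.d j (chom C.X h x) = chom C.X (by rw [h]) (C.d i x) := by subst h; rfl

/-- A chain map of cochain complexes. -/
structure ChainMap (C D : CochainCpx) where
  f : ∀ n : ℤ, C.X n →+ D.X n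
  comm : ∀ (n : ℤ) (x : C.X n), f (n + 1) (C.d n x) = D.d n (f n x)

lemma ChainMap.f_chom {C D : CochainCpx} (ψ : ChainMap C D) {i j : ℤ} (h : i = j)
    (x : C.X i) : ψ.f j (chom C.X h x) = chom D.X h (ψ.f i x) := by subst h; rfl

/-- Composition of chain maps. -/
def ChainMap.comp {C D E : CochainCpx} (g : ChainMap D E) (f : ChainMap C D) :
    ChainMap C E where
  f n := (g.f n).comp (f.f n)
  comm n x := by simp [ChainMap.comm]

/-- The subgroup of cocycles in degree `k`. -/
abbrev cocycles (C : CochainCpx) (k : ℤ) : AddSubgroup (C.X k) := (C.d k).ker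

/-- The subgroup of coboundaries in degree `k`. -/
abbrev coboundaries (C : CochainCpx) (k : ℤ) : AddSubgroup (C.X k) :=
  ((chom C.X (show k - 1 + 1 = k by omega)).comp (C.d (k - 1))).range

lemma coboundaries_le_cocycles (C : CochainCpx) (k : ℤ) :
    coboundaries C k ≤ cocycles C k := by
  rintro x ⟨y, rfl⟩
  simp only [AddMonoidHom.mem_ker, AddMonoidHom.comp_apply]
  rw [C.d_chom, C.dsq]
  simp

/-- The `k`-th cohomology group of a cochain complex. -/
abbrev cohomology (C : CochainCpx) (k : ℤ) :=
  cocycles C k ⧸ ((coboundaries C k).addSubgroupOf (cocycles C k))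

/-- The cohomology class of a cocycle. -/
def cls (C : CochainCpx) (k : ℤ) (x : C.X k) (hx : C.d k x = 0) : cohomology C k :=
  QuotientAddGroup.mk ⟨x, hx⟩

/-- The map induced on cocycles by a chain map. -/
def cocycleMap {C D : CochainCpx} (ψ : ChainMap C D) (k : ℤ) :
    cocycles C k →+ cocycles D k :=
  AddMonoidHom.codRestrict ((ψ.f k).comp (cocycles C k).subtype) _ fun x => by
    have hx : C.d k x.1 = 0 := x.2
    simp [AddMonoidHom.mem_ker, ← ψ.comm, hx]

lemma map_coboundaries {C D : CochainCpx} (ψ : ChainMap C D) (k : ℤ)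
    {x : C.X k} (hx : x ∈ coboundaries C k) : ψ.f k x ∈ coboundaries D k := by
  obtain ⟨y, rfl⟩ := hx
  refine ⟨ψ.f (k - 1) y, ?_⟩
  rw [AddMonoidHom.comp_apply, AddMonoidHom.comp_apply, ← ψ.comm, ← ψ.f_chom]

/-- The map induced on cohomology by a chain map. -/
def Hmap {C D : CochainCpx} (ψ : ChainMap C D) (k : ℤ) :
    cohomology C k →+ cohomology D k :=
  QuotientAddGroup.map _ _ (cocycleMap ψ k) (by
    intro x hx
    rw [AddSubgroup.mem_addSubgroupOf] at hx
    rw [AddSubgroup.mem_comap, AddSubgroup.mem_addSubgroupOf]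
    exact map_coboundaries ψ k hx)

/-- Degreewise direct sum of two cochain complexes. -/
def dirSum (L F : CochainCpx) : CochainCpx where
  X n := L.X n × F.X n
  grp n := inferInstance
  d n := ((L.d n).comp (AddMonoidHom.fst _ _)).prod ((F.d n).comp (AddMonoidHom.snd _ _))
  dsq n x := by
    show (L.d (n+1) (L.d n x.1), F.d (n+1) (F.d n x.2)) = 0
    rw [L.dsq, F.dsq]
    rfl

/-- The chain map `L ⊕ F → D`, `(l, f) ↦ i(l) + φ(f)`. -/
def pairMap {L F D : CochainCpx} (i : ChainMap L D) (φ : ChainMap F D) :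
    ChainMap (dirSum L F) D where
  f n := ((i.f n).comp (AddMonoidHom.fst _ _)) + ((φ.f n).comp (AddMonoidHom.snd _ _))
  comm n x := by
    show i.f (n+1) ((L.d n) x.1) + φ.f (n+1) ((F.d n) x.2)
      = (D.d n) (i.f n x.1 + φ.f n x.2)
    rw [map_add, i.comm, φ.comm]

/-- The mapping cone of a chain map `ψ : A → B`, with `cone(ψ)^m = A^m ⊕ B^{m-1}` and
differential `d(x, y) = (d x, ψ(x) − d y)`. -/
def cone {A B : CochainCpx} (ψ : ChainMap A B) : CochainCpx where
  X m := A.X m × B.X (m - 1)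
  grp m := inferInstance
  d m := ((A.d m).comp (AddMonoidHom.fst _ _)).prod
      (((chom B.X (show m = m + 1 - 1 by omega)).comp
          ((ψ.f m).comp (AddMonoidHom.fst _ _))) -
       ((chom B.X (show m - 1 + 1 = m + 1 - 1 by omega)).comp
          ((B.d (m - 1)).comp (AddMonoidHom.snd _ _))))
  dsq m x := by
    simp only [AddMonoidHom.prod_apply, AddMonoidHom.comp_apply, AddMonoidHom.coe_fst,
      AddMonoidHom.coe_snd, AddMonoidHom.sub_apply, map_sub]
    rw [A.dsq, ψ.comm, B.d_chom, B.d_chom, chom_chom, chom_chom]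
    rw [show B.d (m - 1 + 1) ((B.d (m-1)) x.2) = 0 from B.dsq _ _]
    simp only [map_zero, sub_zero]
    rw [sub_self]
    rfl

/-- The degreewise kernel of a chain map, as a subcomplex. -/
def kerCpx {A B : CochainCpx} (ψ : ChainMap A B) : CochainCpx where
  X n := (ψ.f n).ker
  grp n := inferInstance
  d n := AddMonoidHom.codRestrict ((A.d n).comp (ψ.f n).ker.subtype) _ fun x => by
    have hx : ψ.f n x.1 = 0 := x.2
    simp [AddMonoidHom.mem_ker, AddMonoidHom.comp_apply, ψ.comm, hx]
  dsq n x := Subtype.ext (by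
    show A.d (n+1) (A.d n x.1) = 0
    exact A.dsq n x.1)

/-- The degreewise cokernel of a chain map, as a quotient complex. -/
def cokerCpx {A B : CochainCpx} (ψ : ChainMap A B) : CochainCpx where
  X n := B.X n ⧸ (ψ.f n).range
  grp n := inferInstance
  d n := QuotientAddGroup.map _ _ (B.d n) (by
    rintro x ⟨a, rfl⟩
    exact ⟨A.d n a, ψ.comm n a⟩)
  dsq n x := by
    induction x using QuotientAddGroup.induction_on with
    | H b =>
      show QuotientAddGroup.map _ _ _ _ (QuotientAddGroup.map _ _ _ _ ((QuotientAddGroup.mk b))) = 0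
      rw [QuotientAddGroup.map_mk, QuotientAddGroup.map_mk, B.dsq]
      rfl

/-- The degreewise quotient chain map onto the cokernel complex. -/
def cokerProj {A B : CochainCpx} (ψ : ChainMap A B) : ChainMap B (cokerCpx ψ) where
  f n := QuotientAddGroup.mk' (ψ.f n).range
  comm _ _ := rfl

/-- The subgroup underlying the brutal truncation `σ_{≥k}` in degree `n`. -/
def truncSub (F : CochainCpx) (k n : ℤ) : AddSubgroup (F.X n) where
  carrier := {x | n < k → x = 0}
  zero_mem' := fun _ => rfl
  add_mem' := by
    intro a b ha hb
    intro h
    show a + b = 0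
    rw [ha h, hb h, add_zero]
  neg_mem' := by
    intro a ha h
    show -a = 0
    rw [ha h, neg_zero]

/-- The brutal truncation `σ_{≥k}F`: equal to `F` in degrees `≥ k`, zero below. -/
def truncGE (F : CochainCpx) (k : ℤ) : CochainCpx where
  X n := truncSub F k n
  grp n := inferInstance
  d n := AddMonoidHom.codRestrict ((F.d n).comp (truncSub F k n).subtype) _ fun x => by
    intro h
    show F.d n x.1 = 0
    rw [x.2 (by omega), map_zero]
  dsq n x := Subtype.ext (by
    show F.d (n+1) (F.d n x.1) = 0
    exact F.dsq n x.1)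

/-- The inclusion `σ_{≥k}F ↪ F`. -/
def truncGEIncl (F : CochainCpx) (k : ℤ) : ChainMap (truncGE F k) F where
  f n := (truncSub F k n).subtype
  comm _ _ := rfl

/-- The subgroup underlying the brutal truncation `σ_{<k}` in degree `n`. -/
def truncLTSub (F : CochainCpx) (k n : ℤ) : AddSubgroup (F.X n) where
  carrier := {x | k ≤ n → x = 0}
  zero_mem' := fun _ => rfl
  add_mem' := by
    intro a b ha hb h
    show a + b = 0
    rw [ha h, hb h, add_zero]
  neg_mem' := by
    intro a ha h
    show -a = 0
    rw [ha h, neg_zero]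

/-- The brutal truncation `σ_{<k}F`: equal to `F` in degrees `< k`, zero in degrees `≥ k`. -/
def truncLT (F : CochainCpx) (k : ℤ) : CochainCpx where
  X n := truncLTSub F k n
  grp n := inferInstance
  d n :=
    { toFun := fun x => if h : k ≤ n + 1 then 0 else ⟨F.d n x.1, fun hk => absurd hk h⟩
      map_zero' := by
        split
        · rfl
        · exact Subtype.ext (by simp)
      map_add' := fun a b => by
        split
        · simp
        · exact Subtype.ext (by
            show F.d n (a.1 + b.1) = F.d n a.1 + F.d n b.1
            rw [map_add]) }
  dsq n x := by
    show (if h : k ≤ n + 1 + 1 then 0 else _) = 0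
    split
    · rfl
    · next h =>
      have h1 : ¬ k ≤ n + 1 := by omega
      refine Subtype.ext ?_
      show F.d (n + 1) (↑(if h : k ≤ n + 1 then (0 : truncLTSub F k (n+1)) else ⟨F.d n x.1, fun hk => absurd hk h⟩)) = 0
      rw [dif_neg h1]
      exact F.dsq n x.1

/-- The subgroup of `F^{k-1}` consisting of those `η` with `dη = 0` whose class
`[φ(η)] ∈ H^{k-1}(D)` lies in the image of `i_* : H^{k-1}(L) → H^{k-1}(D)`, i.e. such
that `φ(η) - i(l)` is a coboundary for some cocycle `l ∈ L^{k-1}`. -/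
def clsImKer (L D F : CochainCpx) (i : ChainMap L D) (φ : ChainMap F D) (k : ℤ) :
    AddSubgroup (F.X (k - 1)) where
  carrier := {η | F.d (k - 1) η = 0 ∧ ∃ l : L.X (k - 1), L.d (k - 1) l = 0 ∧
      φ.f (k - 1) η - i.f (k - 1) l ∈ coboundaries D (k - 1)}
  zero_mem' := ⟨map_zero _, 0, map_zero _, by
    simpa using (coboundaries D (k - 1)).zero_mem⟩
  add_mem' := by
    rintro x y ⟨hx, lx, hlx, hbx⟩ ⟨hy, ly, hly, hby⟩
    refine ⟨by rw [map_add, hx, hy, add_zero], lx + ly,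
      by rw [map_add, hlx, hly, add_zero], ?_⟩
    have h := (coboundaries D (k - 1)).add_mem hbx hby
    have : φ.f (k-1) (x + y) - i.f (k-1) (lx + ly)
        = (φ.f (k-1) x - i.f (k-1) lx) + (φ.f (k-1) y - i.f (k-1) ly) := by
      rw [map_add, map_add]; abel
    rw [this]; exact h
  neg_mem' := by
    rintro x ⟨hx, lx, hlx, hbx⟩
    refine ⟨by rw [map_neg, hx, neg_zero], -lx, by rw [map_neg, hlx, neg_zero], ?_⟩
    have h := (coboundaries D (k - 1)).neg_mem hbx
    have : φ.f (k-1) (-x) - i.f (k-1) (-lx) = -(φ.f (k-1) x - i.f (k-1) lx) := by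
      rw [map_neg, map_neg]; abel
    rw [this]; exact h

/-- The differential of a cochain complex, indexed by its target degree. -/
def CochainCpx.dTo (C : CochainCpx) (k : ℤ) : C.X (k - 1) →+ C.X k :=
  (chom C.X (show k - 1 + 1 = k by omega)).comp (C.d (k - 1))

lemma chom_eq_zero_iff (T : ℤ → Type) [∀ n, AddCommGroup (T n)] {i j : ℤ} (h : i = j)
    (x : T i) : chom T h x = 0 ↔ x = 0 := by subst h; rfl

lemma chom_injective (T : ℤ → Type) [∀ n, AddCommGroup (T n)] {i j : ℤ} (h : i = j) :
    Function.Injective (chom T h) := by subst h; exact fun _ _ => id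

lemma CochainCpx.d_dTo (C : CochainCpx) (k : ℤ) (x : C.X (k - 1)) :
    C.d k (C.dTo k x) = 0 :=
  coboundaries_le_cocycles C k ⟨x, rfl⟩

lemma CochainCpx.dTo_dTo (C : CochainCpx) (k : ℤ) (x : C.X (k - 1 - 1)) :
    C.dTo k (C.dTo (k - 1) x) = 0 := by
  rw [CochainCpx.dTo, AddMonoidHom.comp_apply, C.d_dTo, map_zero]

lemma CochainCpx.dTo_eq_zero_iff (C : CochainCpx) (k : ℤ) (x : C.X (k - 1)) :
    C.dTo k x = 0 ↔ C.d (k - 1) x = 0 :=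
  chom_eq_zero_iff _ _ _

lemma ChainMap.f_dTo {C D : CochainCpx} (ψ : ChainMap C D) (k : ℤ) (x : C.X (k - 1)) :
    ψ.f k (C.dTo k x) = D.dTo k (ψ.f (k - 1) x) := by
  simp only [CochainCpx.dTo, AddMonoidHom.comp_apply]
  rw [ψ.f_chom, ψ.comm]

lemma chom_cone {A B : CochainCpx} (ψ : ChainMap A B) {m n : ℤ} (h : m = n)
    (x : A.X m) (y : B.X (m - 1)) :
    chom (cone ψ).X h ((x, y) : A.X m × B.X (m - 1))
      = ((chom A.X h x, chom B.X (by rw [h]) y) : A.X n × B.X (n - 1)) := by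
  subst h; rfl

lemma cone_dTo {A B : CochainCpx} (ψ : ChainMap A B) (k : ℤ)
    (x : A.X (k - 1)) (y : B.X (k - 1 - 1)) :
    (cone ψ).dTo k ((x, y) : A.X (k - 1) × B.X (k - 1 - 1))
      = ((A.dTo k x, ψ.f (k - 1) x - B.dTo (k - 1) y) : A.X k × B.X (k - 1)) := by
  refine (chom_cone ψ _ _ _).trans (Prod.ext rfl ?_)
  simp only [CochainCpx.dTo, AddMonoidHom.comp_apply, AddMonoidHom.sub_apply,
    AddMonoidHom.coe_fst, AddMonoidHom.coe_snd, map_sub, chom_chom]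
  rfl

lemma mem_cocycles_cone {A B : CochainCpx} (ψ : ChainMap A B) (k : ℤ)
    (x : A.X k) (y : B.X (k - 1)) :
    ((x, y) : A.X k × B.X (k - 1)) ∈ cocycles (cone ψ) k
      ↔ A.d k x = 0 ∧ ψ.f k x = B.dTo k y := by
  have h : chom B.X (show k - 1 + 1 = k + 1 - 1 by omega) (B.d (k - 1) y)
      = chom B.X (show k = k + 1 - 1 by omega) (B.dTo k y) := by
    rw [CochainCpx.dTo, AddMonoidHom.comp_apply, chom_chom]
  refine Prod.ext_iff.trans (and_congr Iff.rfl ?_)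
  change chom B.X _ (ψ.f k x) - chom B.X _ (B.d (k - 1) y) = 0 ↔ _
  rw [h, sub_eq_zero, (chom_injective B.X _).eq_iff]

lemma mem_coboundaries_cone {A B : CochainCpx} (ψ : ChainMap A B) (k : ℤ)
    (x : A.X k) (y : B.X (k - 1)) :
    ((x, y) : A.X k × B.X (k - 1)) ∈ coboundaries (cone ψ) k
      ↔ ∃ (a : A.X (k - 1)) (b : B.X (k - 1 - 1)),
        A.dTo k a = x ∧ ψ.f (k - 1) a - B.dTo (k - 1) b = y := by
  constructor
  · rintro ⟨⟨a, b⟩, h⟩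
    exact ⟨a, b, Prod.ext_iff.1 ((cone_dTo ψ k a b).symm.trans h)⟩
  · rintro ⟨a, b, rfl, rfl⟩
    exact ⟨(a, b), cone_dTo ψ k a b⟩

lemma chom_dirSum (L F : CochainCpx) {m n : ℤ} (h : m = n) (x : L.X m) (y : F.X m) :
    chom (dirSum L F).X h ((x, y) : L.X m × F.X m)
      = ((chom L.X h x, chom F.X h y) : L.X n × F.X n) := by
  subst h; rfl

lemma dirSum_dTo (L F : CochainCpx) (k : ℤ) (x : L.X (k - 1)) (y : F.X (k - 1)) :
    (dirSum L F).dTo k ((x, y) : L.X (k - 1) × F.X (k - 1))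
      = ((L.dTo k x, F.dTo k y) : L.X k × F.X k) :=
  chom_dirSum L F _ _ _

lemma truncSub_self (F : CochainCpx) (k : ℤ) (x : F.X k) : x ∈ truncSub F k k :=
  fun h => absurd h (lt_irrefl k)

lemma mem_cocycles_cone_trunc {E F : CochainCpx} (ψ : ChainMap F E) (k : ℤ)
    (x : F.X k) (y : E.X (k - 1)) :
    ((⟨x, truncSub_self F k x⟩, y) : truncSub F k k × E.X (k - 1))
        ∈ cocycles (cone (ψ.comp (truncGEIncl F k))) k
      ↔ F.d k x = 0 ∧ ψ.f k x = E.dTo k y :=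
  (mem_cocycles_cone (ψ.comp (truncGEIncl F k)) k _ _).trans
    (and_congr Subtype.ext_iff Iff.rfl)

lemma mem_coboundaries_cone_trunc {E F : CochainCpx} (ψ : ChainMap F E) (k : ℤ)
    (x : F.X k) (y : E.X (k - 1)) :
    ((⟨x, truncSub_self F k x⟩, y) : truncSub F k k × E.X (k - 1))
        ∈ coboundaries (cone (ψ.comp (truncGEIncl F k))) k
      ↔ x = 0 ∧ ∃ b : E.X (k - 1 - 1), E.dTo (k - 1) b = y := by
  refine (mem_coboundaries_cone (ψ.comp (truncGEIncl F k)) k _ _).trans ⟨?_, ?_⟩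
  · rintro ⟨a, b, h₁, h₂⟩
    obtain rfl : a = 0 := Subtype.ext (a.2 (by omega))
    rw [map_zero] at h₁ h₂
    exact ⟨(congrArg Subtype.val h₁).symm, -b, by rw [← h₂, map_neg, zero_sub]⟩
  · rintro ⟨rfl, b, rfl⟩
    exact ⟨0, -b, by rw [map_zero]; rfl, by rw [map_zero, map_neg, zero_sub, neg_neg]⟩

lemma mem_cocycles_cone_pairMap {L D F : CochainCpx} (i : ChainMap L D) (φ : ChainMap F D)
    (k : ℤ) (l : L.X k) (x : F.X k) (u : D.X (k - 1)) :
    (((l, x), u) : (L.X k × F.X k) × D.X (k - 1)) ∈ cocycles (cone (pairMap i φ)) k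
      ↔ (L.d k l = 0 ∧ F.d k x = 0) ∧ i.f k l + φ.f k x = D.dTo k u :=
  (mem_cocycles_cone (pairMap i φ) k (l, x) u).trans (and_congr Prod.ext_iff Iff.rfl)

lemma mem_coboundaries_cone_pairMap {L D F : CochainCpx} (i : ChainMap L D)
    (φ : ChainMap F D) (k : ℤ) (l : L.X k) (x : F.X k) (u : D.X (k - 1)) :
    (((l, x), u) : (L.X k × F.X k) × D.X (k - 1)) ∈ coboundaries (cone (pairMap i φ)) k
      ↔ ∃ (a : L.X (k - 1)) (η : F.X (k - 1)) (v : D.X (k - 1 - 1)),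
        L.dTo k a = l ∧ F.dTo k η = x ∧
          i.f (k - 1) a + φ.f (k - 1) η - D.dTo (k - 1) v = u := by
  refine (mem_coboundaries_cone (pairMap i φ) k (l, x) u).trans ⟨?_, ?_⟩
  · rintro ⟨⟨a, η⟩, v, h₁, h₂⟩
    have h := Prod.ext_iff.1 ((dirSum_dTo L F k a η).symm.trans h₁)
    exact ⟨a, η, v, h.1, h.2, h₂⟩
  · rintro ⟨a, η, v, rfl, rfl, h⟩
    exact ⟨(a, η), v, dirSum_dTo L F k a η, h⟩

lemma mk_eq_zero_iff_mem_coboundaries (C : CochainCpx) (k : ℤ) (z : cocycles C k) :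
    (QuotientAddGroup.mk z : cohomology C k) = 0 ↔ z.1 ∈ coboundaries C k :=
  (QuotientAddGroup.eq_zero_iff z).trans AddSubgroup.mem_addSubgroupOf

/-- The map `((l, ω), u) ↦ (ω, p u)` on cocycles. -/
def cocyclesPairToTrunc {L D E F : CochainCpx} (i : ChainMap L D) (p : ChainMap D E)
    (hpi : ∀ (n : ℤ) (l : L.X n), p.f n (i.f n l) = 0) (φ : ChainMap F D) (k : ℤ) :
    cocycles (cone (pairMap i φ)) k →+
      cocycles (cone ((p.comp φ).comp (truncGEIncl F k))) k where
  toFun z := ⟨(⟨z.1.1.2, truncSub_self F k z.1.1.2⟩, p.f (k - 1) z.1.2), by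
    obtain ⟨⟨⟨l, x⟩, u⟩, hz⟩ := z
    obtain ⟨⟨-, hx⟩, hu⟩ := (mem_cocycles_cone_pairMap i φ k l x u).1 hz
    refine (mem_cocycles_cone_trunc (p.comp φ) k x _).2 ⟨hx, ?_⟩
    rw [← p.f_dTo, ← hu, map_add, hpi, zero_add]
    rfl⟩
  map_zero' := Subtype.ext (Prod.ext rfl (map_zero (p.f (k - 1))))
  map_add' z w := Subtype.ext (Prod.ext rfl (map_add (p.f (k - 1)) z.1.2 w.1.2))

/-- The map `η ↦ (dη, ψ η)` from `F^{k-1}` to the cocycles of the cone of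
`σ_{≥k}F → E`. -/
def truncConnecting {E F : CochainCpx} (ψ : ChainMap F E) (k : ℤ) :
    F.X (k - 1) →+ cocycles (cone (ψ.comp (truncGEIncl F k))) k where
  toFun η := ⟨(⟨F.dTo k η, truncSub_self F k _⟩, ψ.f (k - 1) η),
    (mem_cocycles_cone_trunc ψ k _ _).2 ⟨F.d_dTo k η, ψ.f_dTo k η⟩⟩
  map_zero' := Subtype.ext
    (Prod.ext (Subtype.ext (map_zero (F.dTo k))) (map_zero (ψ.f (k - 1))))
  map_add' η θ := Subtype.ext
    (Prod.ext (Subtype.ext (map_add (F.dTo k) η θ)) (map_add (ψ.f (k - 1)) η θ))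

lemma comp_eq_zero_of_range_eq_ker {L D E : CochainCpx} (i : ChainMap L D)
    (p : ChainMap D E)
    (hex : ∀ n : ℤ, (i.f n).range = (p.f n).ker)
    (n : ℤ) (l : L.X n) : p.f n (i.f n l) = 0 :=
  (hex n).le ⟨l, rfl⟩

lemma cocyclesPairToTrunc_surjective {L D E F : CochainCpx}
    (i : ChainMap L D) (p : ChainMap D E)
    (hi : ∀ n : ℤ, Function.Injective (i.f n))
    (hp : ∀ n : ℤ, Function.Surjective (p.f n))
    (hex : ∀ n : ℤ, (i.f n).range = (p.f n).ker)
    (φ : ChainMap F D) (k : ℤ) :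
    Function.Surjective
      (cocyclesPairToTrunc i p (comp_eq_zero_of_range_eq_ker i p hex) φ k) := by
  rintro ⟨⟨⟨x, hx'⟩, e⟩, hz⟩
  obtain ⟨hx, he⟩ := (mem_cocycles_cone_trunc (p.comp φ) k x e).1 hz
  obtain ⟨u, rfl⟩ := hp (k - 1) e
  obtain ⟨l, hl⟩ : D.dTo k u - φ.f k x ∈ (i.f k).range := by
    rw [hex, AddMonoidHom.mem_ker, map_sub, p.f_dTo, ← he]
    exact sub_self _
  refine ⟨⟨((l, x), u), (mem_cocycles_cone_pairMap i φ k l x u).2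
    ⟨⟨hi _ ?_, hx⟩, by rw [hl, sub_add_cancel]⟩⟩, rfl⟩
  rw [i.comm, hl, map_sub, D.d_dTo, ← φ.comm, hx, map_zero, map_zero, sub_zero]

lemma mem_coboundaries_of_cocyclesPairToTrunc {L D E F : CochainCpx}
    (i : ChainMap L D) (p : ChainMap D E)
    (hi : ∀ n : ℤ, Function.Injective (i.f n))
    (hp : ∀ n : ℤ, Function.Surjective (p.f n))
    (hex : ∀ n : ℤ, (i.f n).range = (p.f n).ker)
    (φ : ChainMap F D) (k : ℤ)
    (z : cocycles (cone (pairMap i φ)) k)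
    (hz : (cocyclesPairToTrunc i p (comp_eq_zero_of_range_eq_ker i p hex) φ k z).1 ∈
      coboundaries (cone ((p.comp φ).comp (truncGEIncl F k))) k) :
    z.1 ∈ coboundaries (cone (pairMap i φ)) k := by
  obtain ⟨⟨⟨l, x⟩, u⟩, hc⟩ := z
  obtain ⟨-, hu⟩ := (mem_cocycles_cone_pairMap i φ k l x u).1 hc
  obtain ⟨rfl, b, hb⟩ :=
    (mem_coboundaries_cone_trunc (p.comp φ) k x (p.f (k - 1) u)).1 hz
  obtain ⟨v, rfl⟩ := hp _ b
  obtain ⟨a, ha⟩ : u - D.dTo (k - 1) v ∈ (i.f (k - 1)).range := by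
    rw [hex, AddMonoidHom.mem_ker, map_sub, p.f_dTo, hb, sub_self]
  refine (mem_coboundaries_cone_pairMap i φ k l 0 u).2
    ⟨a, 0, -v, hi _ ?_, map_zero _, ?_⟩
  · rw [i.f_dTo, ha, map_sub, D.dTo_dTo, sub_zero, ← hu, map_zero, add_zero]
  · rw [ha, map_zero, map_neg]
    abel

lemma truncConnecting_mem_coboundaries_iff {L D E F : CochainCpx}
    (i : ChainMap L D) (p : ChainMap D E)
    (hi : ∀ n : ℤ, Function.Injective (i.f n))
    (hp : ∀ n : ℤ, Function.Surjective (p.f n))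
    (hex : ∀ n : ℤ, (i.f n).range = (p.f n).ker)
    (φ : ChainMap F D) (k : ℤ) (η : F.X (k - 1)) :
    (truncConnecting (p.comp φ) k η).1 ∈
        coboundaries (cone ((p.comp φ).comp (truncGEIncl F k))) k
      ↔ η ∈ clsImKer L D F i φ k := by
  refine (mem_coboundaries_cone_trunc (p.comp φ) k _ _).trans ?_
  rw [F.dTo_eq_zero_iff]
  refine and_congr_right fun hη => ⟨?_, ?_⟩
  · rintro ⟨b, hb⟩
    obtain ⟨v, rfl⟩ := hp _ b
    obtain ⟨l, hl⟩ : φ.f (k - 1) η - D.dTo (k - 1) v ∈ (i.f (k - 1)).range := by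
      rw [hex, AddMonoidHom.mem_ker, map_sub, p.f_dTo, hb]
      exact sub_self _
    refine ⟨l, hi _ ?_, v, ?_⟩
    · rw [i.comm, hl, map_sub, D.d_dTo, ← φ.comm, hη, map_zero, map_zero, sub_zero]
    · rw [hl, sub_sub_cancel]
      rfl
  · rintro ⟨l, -, v, hv⟩
    replace hv : D.dTo (k - 1) v = φ.f (k - 1) η - i.f (k - 1) l := hv
    refine ⟨p.f _ v, ?_⟩
    rw [← p.f_dTo, hv, map_sub, comp_eq_zero_of_range_eq_ker i p hex, sub_zero]
    rfl

/-- **Theorem 2.4.** Given a degreewise short exact sequence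
`0 → L →(i)→ D →(p)→ E → 0` of ℤ-indexed cochain complexes of abelian groups, a chain
map `φ : F → D`, and `k : ℤ`, there is a surjective group homomorphism
`Ξ : H^k(cone(σ_{≥k}F → E)) → H^k(cone(L ⊕ F → D))` whose kernel is isomorphic to the
quotient of `F^{k-1}` by the subgroup of those `η` with `dη = 0` whose class `[φ(η)]`
lies in the image of `i_* : H^{k-1}(L) → H^{k-1}(D)`. -/
theorem differential_characters_to_multiplicative_cohomology
    (L D E F : CochainCpx) (i : ChainMap L D) (p : ChainMap D E)
    (hi : ∀ n : ℤ, Function.Injective (i.f n))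
    (hp : ∀ n : ℤ, Function.Surjective (p.f n))
    (hex : ∀ n : ℤ, (i.f n).range = (p.f n).ker)
    (φ : ChainMap F D) (k : ℤ) :
    ∃ Ξ : cohomology (cone ((p.comp φ).comp (truncGEIncl F k))) k →+
        cohomology (cone (pairMap i φ)) k,
      Function.Surjective Ξ ∧
      Nonempty (Ξ.ker ≃+ (F.X (k - 1) ⧸ clsImKer L D F i φ k)) := by
  have hpi := comp_eq_zero_of_range_eq_ker i p hex
  let S := cone ((p.comp φ).comp (truncGEIncl F k))
  let T := cone (pairMap i φ)
  let G : cocycles T k →+ cocycles S k := cocyclesPairToTrunc i p hpi φ k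
  let q : cocycles T k →+ cohomology S k := (QuotientAddGroup.mk' _).comp G
  let r : cocycles T k →+ cohomology T k := QuotientAddGroup.mk' _
  let γ : F.X (k - 1) →+ cohomology S k :=
    (QuotientAddGroup.mk' _).comp (truncConnecting (p.comp φ) k)
  have hq : Function.Surjective q := (QuotientAddGroup.mk'_surjective _).comp
    (cocyclesPairToTrunc_surjective i p hi hp hex φ k)
  have hqr : q.ker ≤ r.ker := fun z hz =>
    (mk_eq_zero_iff_mem_coboundaries T k z).2
      (mem_coboundaries_of_cocyclesPairToTrunc i p hi hp hex φ k z
        ((mk_eq_zero_iff_mem_coboundaries S k (G z)).1 hz))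
  let Ξ : cohomology S k →+ cohomology T k := q.liftOfSurjective hq ⟨r, hqr⟩
  have hΞ (z : cocycles T k) : Ξ (q z) = r z :=
    AddMonoidHom.liftOfRightInverse_comp_apply _ _ _ ⟨r, hqr⟩ z
  have hγker : γ.ker = clsImKer L D F i φ k := AddSubgroup.ext fun η =>
    (mk_eq_zero_iff_mem_coboundaries S k _).trans
      (truncConnecting_mem_coboundaries_iff i p hi hp hex φ k η)
  have hγrange : γ.range = Ξ.ker := by
    ext c
    constructor
    · rintro ⟨η, rfl⟩
      have hb : (((0, F.dTo k η), φ.f (k - 1) η) : (L.X k × F.X k) × D.X (k - 1)) ∈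
          coboundaries T k :=
        (mem_coboundaries_cone_pairMap i φ k _ _ _).2
          ⟨0, η, 0, map_zero _, rfl, by simp⟩
      exact (hΞ ⟨_, coboundaries_le_cocycles T k hb⟩).trans
        ((mk_eq_zero_iff_mem_coboundaries T k _).2 hb)
    · intro hc
      obtain ⟨z, rfl⟩ := hq c
      have hz : z.1 ∈ coboundaries T k :=
        (mk_eq_zero_iff_mem_coboundaries T k z).1 ((hΞ z).symm.trans hc)
      obtain ⟨⟨⟨l, x⟩, u⟩, hcz⟩ := z
      obtain ⟨a, η, v, rfl, rfl, rfl⟩ :=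
        (mem_coboundaries_cone_pairMap i φ k l x u).1 hz
      refine ⟨η, sub_eq_zero.1 ?_⟩
      refine (mk_eq_zero_iff_mem_coboundaries S k
        (truncConnecting (p.comp φ) k η - G ⟨_, hcz⟩)).2 ?_
      have hb := (mem_coboundaries_cone_trunc (p.comp φ) k (F.dTo k η - F.dTo k η)
        (p.f (k - 1) (φ.f (k - 1) η) -
          p.f (k - 1) (i.f (k - 1) a + φ.f (k - 1) η - D.dTo (k - 1) v))).2
        ⟨sub_self _, p.f _ v, by
          rw [map_sub, map_add, hpi, p.f_dTo]
          abel⟩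
      exact hb
  refine ⟨Ξ, fun c => ?_, ⟨?_⟩⟩
  · obtain ⟨z, rfl⟩ := QuotientAddGroup.mk'_surjective _ c
    exact ⟨q z, hΞ z⟩
  · exact (AddEquiv.addSubgroupCongr hγrange.symm).trans
      ((QuotientAddGroup.quotientKerEquivRange γ).symm.trans
        (QuotientAddGroup.quotientAddEquivOfEq hγker))
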